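/- Under the boundedness conditions ∫₀¹ sup_{x∈ℝ^d} |b(s,x)| ds < ∞ and ∫₀¹ sup_{x∈ℝ^d} ‖σ(s,x)‖² ds < ∞, the modulus-of-continuity condition, and the local Osgood-type condition, the Euler approximations converge uniformly to the controlled trajectories, uniformly over energy sublevel sets: assume that for every l with e(l) < ∞ the controlled equation driven by l has a solution F(l) on [0,1]; then for every α > 0, lim_{n→∞} sup_{l : e(l) ≤ α} sup_{0 ≤ t ≤ 1} |F_n(l)(t) − F(l)(t)| = 0. -/

import Mathlib

open MeasureTheory Set Metric
open scoped RealInnerProductSpace ENNReal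

noncomputable section

/-- Matrix times vector, landing in Euclidean space. -/
def mVec {d m : ℕ} (A : Matrix (Fin d) (Fin m) ℝ)
    (v : EuclideanSpace ℝ (Fin m)) : EuclideanSpace ℝ (Fin d) :=
  (WithLp.equiv 2 (Fin d → ℝ)).symm fun i => ∑ j, A i j * v j

/-- Transposed matrix times vector (`σᵀ x`), landing in Euclidean space. -/
def mVecT {d m : ℕ} (A : Matrix (Fin d) (Fin m) ℝ)
    (x : EuclideanSpace ℝ (Fin d)) : EuclideanSpace ℝ (Fin m) :=
  (WithLp.equiv 2 (Fin m → ℝ)).symm fun j => ∑ i, A i j * x i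

/-- Square of the Frobenius (Hilbert–Schmidt) norm `‖A‖² = ∑ᵢⱼ Aᵢⱼ²`. -/
def frobSq {d m : ℕ} (A : Matrix (Fin d) (Fin m) ℝ) : ℝ :=
  ∑ i, ∑ j, (A i j) ^ 2

/-- An admissible control: `l'` is (a.e. strongly) measurable on `[0,1]` and
`∫₀¹ ‖l'(t)‖² dt < ∞`; `l'` plays the role of the derivative of an absolutely
continuous path `l` with `l(0) = 0`, so that `e(l) = ∫₀¹ ‖l'(t)‖² dt`. -/
def Adm {m : ℕ} (l' : ℝ → EuclideanSpace ℝ (Fin m)) : Prop :=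
  AEStronglyMeasurable l' (volume.restrict (Icc 0 1)) ∧
    IntegrableOn (fun t => ‖l' t‖ ^ 2) (Icc 0 1)

/-- `h` is a solution on `[0,1]` of the controlled equation
`h(t) = x₀ + ∫₀ᵗ b(s, h(s)) ds + ∫₀ᵗ σ(s, h(s)) l'(s) ds` driven by `l`
(with derivative `l'`). -/
def IsSol {d m : ℕ} (b : ℝ → EuclideanSpace ℝ (Fin d) → EuclideanSpace ℝ (Fin d))
    (σ : ℝ → EuclideanSpace ℝ (Fin d) → Matrix (Fin d) (Fin m) ℝ)
    (x₀ : EuclideanSpace ℝ (Fin d)) (l' : ℝ → EuclideanSpace ℝ (Fin m))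
    (h : ℝ → EuclideanSpace ℝ (Fin d)) : Prop :=
  ContinuousOn h (Icc 0 1) ∧ ∀ t ∈ Icc (0:ℝ) 1,
    h t = x₀ + ∫ s in (0:ℝ)..t, (b s (h s) + mVec (σ s (h s)) (l' s))

/-- `F` is the `n`-th Euler approximation of the controlled trajectory:
`F(t) = x₀ + ∫₀ᵗ b(s, F([ns]/n)) ds + ∫₀ᵗ σ(s, F([ns]/n)) l'(s) ds`. -/
def IsEuler {d m : ℕ} (n : ℕ)
    (b : ℝ → EuclideanSpace ℝ (Fin d) → EuclideanSpace ℝ (Fin d))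
    (σ : ℝ → EuclideanSpace ℝ (Fin d) → Matrix (Fin d) (Fin m) ℝ)
    (x₀ : EuclideanSpace ℝ (Fin d)) (l' : ℝ → EuclideanSpace ℝ (Fin m))
    (F : ℝ → EuclideanSpace ℝ (Fin d)) : Prop :=
  ∀ t ∈ Icc (0:ℝ) 1,
    F t = x₀ + ∫ s in (0:ℝ)..t,
      (b s (F ((⌊(n:ℝ) * s⌋₊ : ℝ) / (n:ℝ))) +
        mVec (σ s (F ((⌊(n:ℝ) * s⌋₊ : ℝ) / (n:ℝ)))) (l' s))

open Filter Topology

theorem MeasureTheory.IntegrableOn.intervalIntegrable_of_mem {F : Type*} [NormedAddCommGroup F]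
    {u : ℝ → F} {T x y : ℝ} (hu : IntegrableOn u (Icc 0 T)) (hx : x ∈ Icc 0 T)
    (hy : y ∈ Icc 0 T) : IntervalIntegrable u volume x y :=
  (hu.mono_set (uIcc_subset_Icc hx hy)).intervalIntegrable

theorem MeasureTheory.IntegrableOn.continuousOn_primitive {F : Type*} [NormedAddCommGroup F]
    [NormedSpace ℝ F] {u : ℝ → F} {T : ℝ} (hu : IntegrableOn u (Icc 0 T)) (hT : 0 ≤ T) :
    ContinuousOn (fun t => ∫ s in (0:ℝ)..t, u s) (Icc 0 T) := by
  rw [← uIcc_of_le hT] at hu ⊢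
  exact intervalIntegral.continuousOn_primitive_interval hu

/-- If near the right of every point the increments of `θ` are bounded by those of `A`, then
`θ ≤ A` on the whole interval. -/
theorem le_on_Icc_of_eventually_increment_le {θ A : ℝ → ℝ} {T : ℝ}
    (hθ : ContinuousOn θ (Icc 0 T)) (hA : ContinuousOn A (Icc 0 T)) (h0 : θ 0 ≤ A 0)
    (hinc : ∀ x ∈ Ico 0 T, ∀ᶠ y in 𝓝[>] x, y ≤ T → θ y - θ x ≤ A y - A x) :
    ∀ t ∈ Icc 0 T, θ t ≤ A t := by
  have hcl : IsClosed ({t | θ t ≤ A t} ∩ Icc 0 T) := by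
    rw [inter_comm]
    exact isClosed_Icc.isClosed_le hθ hA
  refine hcl.Icc_subset_of_forall_exists_gt h0 ?_
  rintro x ⟨hx, hxT⟩ y hy
  have h1 : Ioc x (min y T) ∈ 𝓝[>] x := Ioc_mem_nhdsGT (lt_min hy hxT.2)
  obtain ⟨w, hw, hwx⟩ := ((hinc x hxT).and h1).exists
  refine ⟨w, ?_, hwx.1, hwx.2.trans (min_le_left _ _)⟩
  have := hw (hwx.2.trans (min_le_right _ _))
  have hx' : θ x ≤ A x := hx
  show θ w ≤ A w
  linarith

/-- The energy inequality `‖z t‖² ≤ ∫₀ᵗ 2⟪z, ψ⟫` for a primitive `z` of `ψ`. -/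
theorem norm_sq_le_integral_inner {E : Type*} [NormedAddCommGroup E] [InnerProductSpace ℝ E]
    [CompleteSpace E] {ψ z : ℝ → E} {T : ℝ} (hT : 0 ≤ T) (hψ : IntegrableOn ψ (Icc 0 T))
    (hz : ContinuousOn z (Icc 0 T)) (hzψ : ∀ t ∈ Icc 0 T, z t = ∫ s in (0:ℝ)..t, ψ s) :
    IntegrableOn (fun s => 2 * ⟪z s, ψ s⟫) (Icc 0 T) ∧
      ∀ t ∈ Icc 0 T, ‖z t‖ ^ 2 ≤ ∫ s in (0:ℝ)..t, 2 * ⟪z s, ψ s⟫ := by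
  have hint : IntegrableOn (fun s => 2 * ⟪z s, ψ s⟫) (Icc 0 T) := by
    obtain ⟨C, hC⟩ := isCompact_Icc.exists_bound_of_continuousOn hz
    refine Integrable.const_mul ?_ 2
    refine Integrable.mono' (hψ.norm.const_mul C)
      ((hz.aestronglyMeasurable measurableSet_Icc).inner hψ.aestronglyMeasurable) ?_
    refine (ae_restrict_iff' measurableSet_Icc).2 (ae_of_all _ fun s hs => ?_)
    exact (norm_inner_le_norm _ _).trans
      (mul_le_mul_of_nonneg_right (hC s hs) (norm_nonneg _))
  refine ⟨hint, ?_⟩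
  have h0T : (0:ℝ) ∈ Icc 0 T := ⟨le_rfl, hT⟩
  have hεi : ∀ ε : ℝ, IntegrableOn (fun s => ε * ‖ψ s‖) (Icc 0 T) := fun ε => hψ.norm.const_mul ε
  have key : ∀ ε > 0, ∀ t ∈ Icc 0 T,
      ‖z t‖ ^ 2 ≤ ∫ s in (0:ℝ)..t, (2 * ⟪z s, ψ s⟫ + ε * ‖ψ s‖) := by
    intro ε hε
    have hint' : IntegrableOn (fun s => 2 * ⟪z s, ψ s⟫ + ε * ‖ψ s‖) (Icc 0 T) :=
      hint.add (hεi ε)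
    refine le_on_Icc_of_eventually_increment_le (hz.norm.pow 2) ?_ ?_ ?_
    · exact hint'.continuousOn_primitive hT
    · simp [hzψ 0 h0T]
    · intro x hx
      have hxI : x ∈ Icc 0 T := ⟨hx.1, hx.2.le⟩
      obtain ⟨δ, hδ, hδz⟩ := Metric.continuousOn_iff.1 hz x hxI (ε / 4) (by positivity)
      filter_upwards [Ioo_mem_nhdsGT (show x < x + δ by linarith)] with y hy hyT
      have hyI : y ∈ Icc 0 T := ⟨hx.1.trans hy.1.le, hyT⟩
      have hnear : ∀ s ∈ Icc x y, ‖z s - z x‖ ≤ ε / 4 := by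
        intro s hs
        rw [← dist_eq_norm]
        refine (hδz s ⟨hx.1.trans hs.1, hs.2.trans hyT⟩ ?_).le
        rw [Real.dist_eq, abs_of_nonneg (by linarith [hs.1])]
        linarith [hs.2, hy.2]
      have hdiff : z y - z x = ∫ s in x..y, ψ s := by
        rw [hzψ y hyI, hzψ x hxI, intervalIntegral.integral_interval_sub_left
          (hψ.intervalIntegrable_of_mem h0T hyI) (hψ.intervalIntegrable_of_mem h0T hxI)]
      have hsq : ‖z y‖ ^ 2 - ‖z x‖ ^ 2 = ∫ s in x..y, ⟪z y + z x, ψ s⟫ := by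
        have h1 : ∫ s in x..y, ⟪z y + z x, ψ s⟫ = ⟪z y + z x, ∫ s in x..y, ψ s⟫ :=
          (innerSL ℝ (z y + z x)).intervalIntegral_comp_comm (hψ.intervalIntegrable_of_mem hxI hyI)
        rw [h1, ← hdiff, inner_add_left, inner_sub_right, inner_sub_right,
          real_inner_self_eq_norm_sq, real_inner_self_eq_norm_sq, real_inner_comm]
        ring
      rw [hsq, intervalIntegral.integral_interval_sub_left
          (hint'.intervalIntegrable_of_mem h0T hyI) (hint'.intervalIntegrable_of_mem h0T hxI)]
      refine intervalIntegral.integral_mono_on hy.1.le ?_ (hint'.intervalIntegrable_of_mem hxI hyI) ?_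
      · have : IntegrableOn (fun s => ⟪z y + z x, ψ s⟫) (Icc 0 T) :=
          (innerSL ℝ (z y + z x)).integrable_comp hψ
        exact this.intervalIntegrable_of_mem hxI hyI
      · intro s hs
        have h2 : ⟪z y + z x, ψ s⟫ = 2 * ⟪z s, ψ s⟫ + ⟪z y + z x - (2:ℝ) • z s, ψ s⟫ := by
          rw [inner_sub_left, real_inner_smul_left]; ring
        rw [h2]
        gcongr
        refine (real_inner_le_norm _ _).trans (mul_le_mul_of_nonneg_right ?_ (norm_nonneg _))
        have h3 : z y + z x - (2:ℝ) • z s = (z y - z x) - (2:ℝ) • (z s - z x) := by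
          module
        rw [h3]
        refine (norm_sub_le _ _).trans ?_
        rw [norm_smul, Real.norm_ofNat]
        linarith [hnear y ⟨hy.1.le, le_rfl⟩, hnear s hs]
  intro t ht
  have hnn : 0 ≤ ∫ s in (0:ℝ)..t, ‖ψ s‖ :=
    intervalIntegral.integral_nonneg ht.1 fun _ _ => norm_nonneg _
  have hlim : ∀ ε > 0, ‖z t‖ ^ 2 ≤ (∫ s in (0:ℝ)..t, 2 * ⟪z s, ψ s⟫)
      + ε * ∫ s in (0:ℝ)..t, ‖ψ s‖ := by
    intro ε hε
    have := key ε hε t ht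
    rwa [intervalIntegral.integral_add (hint.intervalIntegrable_of_mem h0T ht)
      ((hεi ε).intervalIntegrable_of_mem h0T ht), intervalIntegral.integral_const_mul ε] at this
  refine le_of_forall_pos_le_add fun ε hε => ?_
  refine (hlim (ε / ((∫ s in (0:ℝ)..t, ‖ψ s‖) + 1)) (by positivity)).trans ?_
  gcongr
  rw [div_mul_eq_mul_div, div_le_iff₀ (by positivity)]
  nlinarith

/-- A quantitative Bihari inequality. -/
theorem integral_inv_le_of_le_add_integral {φ g ξ : ℝ → ℝ} {a T : ℝ} (ha : 0 < a) (hT : 0 ≤ T)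
    (hφ : Continuous φ) (hφm : Monotone φ) (hφpos : ∀ u, 0 < u → 0 < φ u)
    (hg : ∀ t, 0 ≤ g t) (hgi : IntegrableOn g (Icc 0 T)) (hξ : ContinuousOn ξ (Icc 0 T))
    (hξ0 : ∀ t ∈ Icc 0 T, 0 ≤ φ (ξ t))
    (h : ∀ t ∈ Icc 0 T, ξ t ≤ a + ∫ s in (0:ℝ)..t, g s * φ (ξ s)) :
    ∃ w, ξ T ≤ w ∧ a ≤ w ∧ ∫ u in a..w, (φ u)⁻¹ ≤ 2 * ∫ s in (0:ℝ)..T, g s := by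
  have hint : IntegrableOn (fun s => g s * φ (ξ s)) (Icc 0 T) :=
    hgi.mul_continuousOn (hφ.comp_continuousOn hξ) isCompact_Icc
  have h0T : (0:ℝ) ∈ Icc 0 T := ⟨le_rfl, hT⟩
  set v : ℝ → ℝ := fun t => a + ∫ s in (0:ℝ)..t, g s * φ (ξ s) with hv
  have hvc : ContinuousOn v (Icc 0 T) := continuousOn_const.add (hint.continuousOn_primitive hT)
  have hva : ∀ t ∈ Icc 0 T, a ≤ v t := fun t ht =>
    le_add_of_nonneg_right (intervalIntegral.integral_nonneg ht.1 fun s hs =>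
      mul_nonneg (hg s) (hξ0 s ⟨hs.1, hs.2.trans ht.2⟩))
  have hvinc : ∀ x ∈ Icc 0 T, ∀ y ∈ Icc 0 T, v y - v x = ∫ s in x..y, g s * φ (ξ s) := by
    intro x hx y hy
    simp only [hv, add_sub_add_left_eq_sub]
    exact intervalIntegral.integral_interval_sub_left (hint.intervalIntegrable_of_mem h0T hy) (hint.intervalIntegrable_of_mem h0T hx)
  have hinvc : ContinuousOn (fun u => (φ u)⁻¹) (Ioi 0) :=
    hφ.continuousOn.inv₀ fun u hu => (hφpos u hu).ne'
  have hii : ∀ x y : ℝ, 0 < x → 0 < y → IntervalIntegrable (fun u => (φ u)⁻¹) volume x y :=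
    fun x y hx hy => (hinvc.mono fun u hu => lt_of_lt_of_le (lt_min hx hy) hu.1).intervalIntegrable
  refine ⟨v T, h T ⟨hT, le_rfl⟩, hva T ⟨hT, le_rfl⟩, ?_⟩
  refine le_on_Icc_of_eventually_increment_le (θ := fun t => ∫ u in a..v t, (φ u)⁻¹)
    (A := fun t => 2 * ∫ s in (0:ℝ)..t, g s) ?_ (continuousOn_const.mul (hgi.continuousOn_primitive hT)) ?_ ?_
    T ⟨hT, le_rfl⟩
  · have hM : ∃ M, ∀ t ∈ Icc 0 T, v t ≤ M := by
      obtain ⟨C, hC⟩ := isCompact_Icc.exists_bound_of_continuousOn hvc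
      exact ⟨C, fun t ht => (le_abs_self _).trans (hC t ht)⟩
    obtain ⟨M, hM⟩ := hM
    have haM : a ≤ M := (hva 0 h0T).trans (hM 0 h0T)
    have h1 := intervalIntegral.continuousOn_primitive_interval' (hii a M ha (ha.trans_le haM))
      left_mem_uIcc
    rw [uIcc_of_le haM] at h1
    exact h1.comp hvc fun t ht => ⟨hva t ht, hM t ht⟩
  · simp [hv]
  · intro x hx
    have hxI : x ∈ Icc 0 T := ⟨hx.1, hx.2.le⟩
    have hvx : 0 < v x := ha.trans_le (hva x hxI)
    have hev : ∀ᶠ y in 𝓝[Icc 0 T] x, φ (v y) < 2 * φ (v x) := by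
      have : Tendsto (fun y => φ (v y)) (𝓝[Icc 0 T] x) (𝓝 (φ (v x))) :=
        (hφ.tendsto _).comp (hvc x hxI)
      exact this.eventually_lt_const (by linarith [hφpos _ hvx])
    have hev' : ∀ᶠ y in 𝓝[>] x, y ∈ Icc 0 T → φ (v y) < 2 * φ (v x) :=
      (eventually_nhdsWithin_iff.1 hev).filter_mono nhdsWithin_le_nhds
    filter_upwards [hev', self_mem_nhdsWithin] with y hy hxy hyT
    have hxy : x < y := hxy
    have hyI : y ∈ Icc 0 T := ⟨hx.1.trans hxy.le, hyT⟩
    have hy := hy hyI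
    have hvy : 0 < v y := ha.trans_le (hva y hyI)
    have hvmono : ∀ s ∈ Icc x y, v s ≤ v y := by
      intro s hs
      have hsI : s ∈ Icc 0 T := ⟨hx.1.trans hs.1, hs.2.trans hyT⟩
      rw [← sub_nonneg, hvinc s hsI y hyI]
      exact intervalIntegral.integral_nonneg hs.2 fun r hr =>
        mul_nonneg (hg r) (hξ0 r ⟨hsI.1.trans hr.1, hr.2.trans hyT⟩)
    rw [intervalIntegral.integral_interval_sub_left (hii a _ ha hvy) (hii a _ ha hvx), ← mul_sub,
      intervalIntegral.integral_interval_sub_left (hgi.intervalIntegrable_of_mem h0T hyI) (hgi.intervalIntegrable_of_mem h0T hxI)]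
    have e1 : ∫ u in v x..v y, (φ u)⁻¹ ≤ (v y - v x) * (φ (v x))⁻¹ := by
      rw [← smul_eq_mul, ← intervalIntegral.integral_const]
      refine intervalIntegral.integral_mono_on (hvmono x ⟨le_rfl, hxy.le⟩) (hii _ _ hvx hvy)
        intervalIntegrable_const fun u hu => ?_
      exact inv_anti₀ (hφpos _ hvx) (hφm hu.1)
    have e2 : v y - v x ≤ (∫ s in x..y, g s) * (2 * φ (v x)) := by
      rw [hvinc x hxI y hyI, ← intervalIntegral.integral_mul_const]
      refine intervalIntegral.integral_mono_on hxy.le (hint.intervalIntegrable_of_mem hxI hyI)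
        ((hgi.intervalIntegrable_of_mem hxI hyI).mul_const _) fun s hs => ?_
      refine mul_le_mul_of_nonneg_left ?_ (hg s)
      have hsI : s ∈ Icc 0 T := ⟨hx.1.trans hs.1, hs.2.trans hyT⟩
      exact (hφm ((h s hsI).trans (hvmono s hs))).trans hy.le
    refine e1.trans ?_
    rw [← div_eq_mul_inv, div_le_iff₀ (hφpos _ hvx)]
    linarith

/-- Divergence at `0` of the integral of `1/η` makes its truncations arbitrarily large. -/
theorem exists_lt_integral_inv_of_lintegral_eq_top {η : ℝ → ℝ} {ρ : ℝ} (hρ : 0 < ρ)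
    (hη : ContinuousOn η (Ioc 0 ρ)) (hpos : ∀ u ∈ Ioc 0 ρ, 0 < η u)
    (htop : ∫⁻ u in Ioc (0:ℝ) ρ, ENNReal.ofReal (1 / η u) = ⊤) (K : ℝ) :
    ∃ a ∈ Ioo 0 ρ, K < ∫ u in a..ρ, (η u)⁻¹ := by
  by_contra! hcon
  have hU : Ioc (0:ℝ) ρ = ⋃ n : ℕ, Ioc (ρ / (n + 2)) ρ := by
    ext u
    simp only [mem_Ioc, mem_iUnion]
    constructor
    · rintro ⟨h0, h1⟩
      obtain ⟨n, hn⟩ := exists_nat_gt (ρ / u)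
      refine ⟨n, ?_, h1⟩
      rw [div_lt_iff₀ h0] at hn
      rw [div_lt_iff₀ (by positivity)]
      nlinarith
    · rintro ⟨n, h0, h1⟩
      exact ⟨lt_trans (by positivity) h0, h1⟩
  have hdir : Directed (· ⊆ ·) fun n : ℕ => Ioc (ρ / ((n:ℝ) + 2)) ρ := by
    refine Monotone.directed_le (f := fun n : ℕ => Ioc (ρ / ((n:ℝ) + 2)) ρ) fun n k hnk => ?_
    refine Ioc_subset_Ioc_left ?_
    gcongr
  have hle : ∫⁻ u in Ioc (0:ℝ) ρ, ENNReal.ofReal (1 / η u) ≤ ENNReal.ofReal K := by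
    rw [hU, setLIntegral_iUnion_of_directed _ hdir]
    refine iSup_le fun n => ?_
    have ha0 : 0 < ρ / ((n:ℝ) + 2) := by positivity
    have haρ : ρ / ((n:ℝ) + 2) < ρ := by
      rw [div_lt_iff₀ (by positivity)]
      nlinarith [(Nat.cast_nonneg n : (0:ℝ) ≤ n)]
    have hK := hcon _ ⟨ha0, haρ⟩
    have hsub : Icc (ρ / ((n:ℝ) + 2)) ρ ⊆ Ioc 0 ρ := fun u hu => ⟨ha0.trans_le hu.1, hu.2⟩
    have hi : IntegrableOn (fun u => (η u)⁻¹) (Ioc (ρ / ((n:ℝ) + 2)) ρ) :=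
      (((hη.mono hsub).inv₀ fun u hu => (hpos u (hsub hu)).ne').integrableOn_Icc).mono_set
        Ioc_subset_Icc_self
    rw [intervalIntegral.integral_of_le haρ.le] at hK
    simp only [one_div]
    rw [← ofReal_integral_eq_lintegral_ofReal hi]
    · exact ENNReal.ofReal_le_ofReal hK
    · refine (ae_restrict_iff' measurableSet_Ioc).2 (ae_of_all _ fun u hu => ?_)
      exact (inv_pos.2 (hpos u (hsub (Ioc_subset_Icc_self hu)))).le
  rw [htop] at hle
  exact ENNReal.ofReal_ne_top (top_le_iff.1 hle)

/-- A family of functions, continuous in the space variable, whose supremum has finite integral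
admits an integrable majorant. -/
theorem exists_integrable_majorant {E : Type*} [TopologicalSpace E] [TopologicalSpace.SeparableSpace E] [Nonempty E]
    {g : ℝ → E → ℝ} (hm : ∀ x, Measurable fun s => g s x)
    (hc : ∀ s ∈ Icc (0:ℝ) 1, Continuous (g s))
    (hfin : ∫⁻ s in Icc (0:ℝ) 1, ⨆ x, ENNReal.ofReal (g s x) < ⊤) :
    ∃ B : ℝ → ℝ, (∀ s, 0 ≤ B s) ∧ IntegrableOn B (Icc 0 1) ∧
      ∀ᵐ s ∂(volume.restrict (Icc (0:ℝ) 1)), ∀ x, g s x ≤ B s := by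
  set u : ℝ → ℝ≥0∞ := fun s => ⨆ n : ℕ, ENNReal.ofReal (g s (TopologicalSpace.denseSeq E n)) with hu
  have hum : Measurable u := Measurable.iSup fun n => (hm _).ennreal_ofReal
  have hufin : ∫⁻ s in Icc (0:ℝ) 1, u s < ⊤ :=
    (lintegral_mono fun s => iSup_le fun n =>
      le_iSup (fun x => ENNReal.ofReal (g s x)) (TopologicalSpace.denseSeq E n)).trans_lt hfin
  refine ⟨fun s => (u s).toReal, fun s => ENNReal.toReal_nonneg,
    integrable_toReal_of_lintegral_ne_top hum.aemeasurable hufin.ne, ?_⟩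
  filter_upwards [ae_lt_top hum hufin.ne, ae_restrict_mem measurableSet_Icc] with s hs hsI x
  have hcl : IsClosed {x | g s x ≤ (u s).toReal} := isClosed_le (hc s hsI) continuous_const
  have hd : ∀ n, TopologicalSpace.denseSeq E n ∈ {x | g s x ≤ (u s).toReal} := fun n =>
    (ENNReal.ofReal_le_iff_le_toReal hs.ne).1
      (le_iSup (fun n : ℕ => ENNReal.ofReal (g s (TopologicalSpace.denseSeq E n))) n)
  exact (TopologicalSpace.denseRange_denseSeq E).induction_on x hcl hd

theorem mVec_apply {d m : ℕ} (A : Matrix (Fin d) (Fin m) ℝ) (v : EuclideanSpace ℝ (Fin m))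
    (i : Fin d) : mVec A v i = ∑ j, A i j * v j := rfl

theorem mVecT_apply {d m : ℕ} (A : Matrix (Fin d) (Fin m) ℝ) (x : EuclideanSpace ℝ (Fin d))
    (j : Fin m) : mVecT A x j = ∑ i, A i j * x i := rfl

theorem mVec_sub {d m : ℕ} (A B : Matrix (Fin d) (Fin m) ℝ) (v : EuclideanSpace ℝ (Fin m)) :
    mVec (A - B) v = mVec A v - mVec B v := by
  ext i
  simp [mVec_apply, sub_mul]

theorem inner_mVec {d m : ℕ} (A : Matrix (Fin d) (Fin m) ℝ) (x : EuclideanSpace ℝ (Fin d))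
    (v : EuclideanSpace ℝ (Fin m)) : ⟪x, mVec A v⟫ = ⟪mVecT A x, v⟫ := by
  simp only [PiLp.inner_apply, mVec_apply, mVecT_apply, RCLike.inner_apply, conj_trivial,
    Finset.sum_mul, Finset.mul_sum]
  rw [Finset.sum_comm]
  refine Finset.sum_congr rfl fun j _ => Finset.sum_congr rfl fun i _ => ?_
  ring

theorem norm_mVec_le {d m : ℕ} (A : Matrix (Fin d) (Fin m) ℝ) (v : EuclideanSpace ℝ (Fin m)) :
    ‖mVec A v‖ ≤ √(frobSq A) * ‖v‖ := by
  have h0 : 0 ≤ frobSq A := Finset.sum_nonneg fun i _ => Finset.sum_nonneg fun j _ => sq_nonneg _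
  rw [EuclideanSpace.norm_eq, EuclideanSpace.norm_eq, ← Real.sqrt_mul h0]
  refine Real.sqrt_le_sqrt ?_
  simp only [frobSq, Finset.sum_mul, Real.norm_eq_abs, sq_abs, mVec_apply]
  refine Finset.sum_le_sum fun i _ => ?_
  rw [← Finset.sum_mul]
  exact Finset.sum_mul_sq_le_sq_mul_sq _ _ _

theorem abs_entry_le_sqrt_frobSq {d m : ℕ} (A : Matrix (Fin d) (Fin m) ℝ) (i : Fin d)
    (j : Fin m) : |A i j| ≤ √(frobSq A) := by
  refine Real.abs_le_sqrt ?_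
  refine (Finset.single_le_sum (f := fun j => A i j ^ 2) (fun j _ => sq_nonneg _)
    (Finset.mem_univ j)).trans ?_
  exact Finset.single_le_sum (f := fun i => ∑ j, A i j ^ 2)
    (fun i _ => Finset.sum_nonneg fun j _ => sq_nonneg _) (Finset.mem_univ i)

/-- The velocity field of the controlled equation evaluated along a path `h`. -/
def velocity {d m : ℕ} (b : ℝ → EuclideanSpace ℝ (Fin d) → EuclideanSpace ℝ (Fin d))
    (σ : ℝ → EuclideanSpace ℝ (Fin d) → Matrix (Fin d) (Fin m) ℝ)
    (l' : ℝ → EuclideanSpace ℝ (Fin m)) (h : ℝ → EuclideanSpace ℝ (Fin d)) (s : ℝ) :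
    EuclideanSpace ℝ (Fin d) :=
  b s (h s) + mVec (σ s (h s)) (l' s)

section Velocity

variable {d m : ℕ} {b : ℝ → EuclideanSpace ℝ (Fin d) → EuclideanSpace ℝ (Fin d)}
  {σ : ℝ → EuclideanSpace ℝ (Fin d) → Matrix (Fin d) (Fin m) ℝ}
  {l' : ℝ → EuclideanSpace ℝ (Fin m)} {h : ℝ → EuclideanSpace ℝ (Fin d)} {B S : ℝ → ℝ}

theorem aestronglyMeasurable_velocity {μ : Measure ℝ} (hbmeas : Measurable (Function.uncurry b))
    (hσmeas : ∀ i j, Measurable fun p : ℝ × EuclideanSpace ℝ (Fin d) => σ p.1 p.2 i j)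
    (hl : AEStronglyMeasurable l' μ) (hh : AEMeasurable h μ) :
    AEStronglyMeasurable (velocity b σ l' h) μ := by
  have hp : AEMeasurable (fun s => (s, h s)) μ := aemeasurable_id.prodMk hh
  refine AEMeasurable.aestronglyMeasurable (AEMeasurable.add (hbmeas.comp_aemeasurable hp) ?_)
  have hl' : ∀ j, AEMeasurable (fun s => l' s j) μ := fun j =>
    ((EuclideanSpace.proj (𝕜 := ℝ) j).continuous.measurable).comp_aemeasurable hl.aemeasurable
  have : AEMeasurable (fun s i => ∑ j, σ s (h s) i j * l' s j) μ :=
    aemeasurable_pi_lambda _ fun i => Finset.aemeasurable_fun_sum _ fun j _ =>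
      ((hσmeas i j).comp_aemeasurable hp).mul (hl' j)
  exact (WithLp.measurable_toLp 2 _).comp_aemeasurable this

/-- Young's inequality with weight for the velocity field. -/
theorem norm_velocity_le {s c : ℝ} (hc : 0 < c) (hB : ∀ x, ‖b s x‖ ≤ B s)
    (hS : ∀ x, frobSq (σ s x) ≤ S s) :
    ‖velocity b σ l' h s‖ ≤ B s + c / 2 * S s + ‖l' s‖ ^ 2 / (2 * c) := by
  refine (norm_add_le _ _).trans ?_
  have h1 := norm_mVec_le (σ s (h s)) (l' s)
  have h0 : 0 ≤ frobSq (σ s (h s)) :=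
    Finset.sum_nonneg fun i _ => Finset.sum_nonneg fun j _ => sq_nonneg _
  have h2 : √(frobSq (σ s (h s))) * ‖l' s‖ ≤
      c / 2 * frobSq (σ s (h s)) + ‖l' s‖ ^ 2 / (2 * c) := by
    have h3 : 0 ≤ (c * √(frobSq (σ s (h s))) - ‖l' s‖) ^ 2 / (2 * c) := by positivity
    have h4 : (c * √(frobSq (σ s (h s))) - ‖l' s‖) ^ 2 / (2 * c) =
        c / 2 * √(frobSq (σ s (h s))) ^ 2 + ‖l' s‖ ^ 2 / (2 * c)
          - √(frobSq (σ s (h s))) * ‖l' s‖ := by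
      field_simp
      ring
    rw [h4, Real.sq_sqrt h0] at h3
    linarith
  have h5 : c / 2 * frobSq (σ s (h s)) ≤ c / 2 * S s :=
    mul_le_mul_of_nonneg_left (hS _) (by positivity)
  linarith [hB (h s)]

theorem integrableOn_velocity (hbmeas : Measurable (Function.uncurry b))
    (hσmeas : ∀ i j, Measurable fun p : ℝ × EuclideanSpace ℝ (Fin d) => σ p.1 p.2 i j)
    (hBi : IntegrableOn B (Icc 0 1)) (hSi : IntegrableOn S (Icc 0 1))
    (hB : ∀ᵐ s ∂(volume.restrict (Icc (0:ℝ) 1)), ∀ x, ‖b s x‖ ≤ B s)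
    (hS : ∀ᵐ s ∂(volume.restrict (Icc (0:ℝ) 1)), ∀ x, frobSq (σ s x) ≤ S s)
    (hl : Adm l') (hh : AEMeasurable h (volume.restrict (Icc (0:ℝ) 1))) :
    IntegrableOn (velocity b σ l' h) (Icc 0 1) := by
  refine Integrable.mono' ((hBi.add (hSi.const_mul (1 / 2))).add (hl.2.div_const (2 * 1)))
    (aestronglyMeasurable_velocity hbmeas hσmeas hl.1 hh) ?_
  filter_upwards [hB, hS] with s h1 h2
  exact norm_velocity_le one_pos h1 h2

/-- Modulus of continuity of a trajectory, uniform over an energy sublevel set. -/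
theorem norm_integral_velocity_le (hBi : IntegrableOn B (Icc 0 1)) (hSi : IntegrableOn S (Icc 0 1))
    (hB : ∀ᵐ s ∂(volume.restrict (Icc (0:ℝ) 1)), ∀ x, ‖b s x‖ ≤ B s)
    (hS : ∀ᵐ s ∂(volume.restrict (Icc (0:ℝ) 1)), ∀ x, frobSq (σ s x) ≤ S s)
    (hl : Adm l') {α c x y : ℝ} (hα : (∫ t in Icc (0:ℝ) 1, ‖l' t‖ ^ 2) ≤ α) (hc : 0 < c)
    (hx : x ∈ Icc (0:ℝ) 1) (hy : y ∈ Icc (0:ℝ) 1) (hxy : x ≤ y) :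
    ‖∫ s in x..y, velocity b σ l' h s‖ ≤ (∫ s in x..y, (B s + c / 2 * S s)) + α / (2 * c) := by
  have hI : IntegrableOn (fun s => B s + c / 2 * S s) (Icc 0 1) := hBi.add (hSi.const_mul (c / 2))
  have hE : IntegrableOn (fun s => ‖l' s‖ ^ 2 / (2 * c)) (Icc 0 1) := hl.2.div_const (2 * c)
  have hsub : Ioc x y ⊆ Icc 0 1 := Ioc_subset_Icc_self.trans (Icc_subset_Icc hx.1 hy.2)
  have h1 : ‖∫ s in x..y, velocity b σ l' h s‖ ≤
      ∫ s in x..y, (B s + c / 2 * S s + ‖l' s‖ ^ 2 / (2 * c)) := by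
    refine intervalIntegral.norm_integral_le_of_norm_le hxy ?_
      ((hI.add hE).intervalIntegrable_of_mem hx hy)
    rw [ae_restrict_iff' measurableSet_Icc] at hB hS
    filter_upwards [hB, hS] with s h1 h2 hs
    exact norm_velocity_le hc (h1 (hsub hs)) (h2 (hsub hs))
  rw [intervalIntegral.integral_add (hI.intervalIntegrable_of_mem hx hy)
    (hE.intervalIntegrable_of_mem hx hy)] at h1
  refine h1.trans ?_
  gcongr
  rw [intervalIntegral.integral_div, intervalIntegral.integral_of_le hxy]
  gcongr
  refine le_trans (setIntegral_mono_set hl.2 ?_ hsub.eventuallyLE) hα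
  exact ae_of_all _ fun s => sq_nonneg _

end Velocity

/-- Integrability of `2 f (1 + ‖l'‖)` for `f` square integrable, with a bound depending on `l'`
only through its energy. -/
theorem integrableOn_mul_one_add_norm {m : ℕ} {l' : ℝ → EuclideanSpace ℝ (Fin m)} {f : ℝ → ℝ}
    (hf : ∀ t, 0 ≤ f t) (hfi : IntegrableOn (fun t => f t ^ 2) (Icc 0 1)) (hl : Adm l') {α : ℝ}
    (hα : (∫ t in Icc (0:ℝ) 1, ‖l' t‖ ^ 2) ≤ α) :
    IntegrableOn (fun t => 2 * f t * (1 + ‖l' t‖)) (Icc 0 1) ∧ ∀ T ∈ Icc (0:ℝ) 1,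
      ∫ t in (0:ℝ)..T, 2 * f t * (1 + ‖l' t‖) ≤ 2 * (∫ t in Icc (0:ℝ) 1, f t ^ 2) + 1 + α := by
  have hfm : AEStronglyMeasurable f (volume.restrict (Icc (0:ℝ) 1)) := by
    have h1 : f = fun t => √(f t ^ 2) := funext fun t => (Real.sqrt_sq (hf t)).symm
    rw [h1]
    exact Real.continuous_sqrt.comp_aestronglyMeasurable hfi.aestronglyMeasurable
  have hnn : ∀ t, 0 ≤ 2 * f t * (1 + ‖l' t‖) := fun t =>
    mul_nonneg (mul_nonneg two_pos.le (hf t)) (by positivity)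
  have hle : ∀ t, 2 * f t * (1 + ‖l' t‖) ≤ 2 * f t ^ 2 + 1 + ‖l' t‖ ^ 2 := fun t => by
    nlinarith [sq_nonneg (f t - 1), sq_nonneg (f t - ‖l' t‖)]
  have hone : IntegrableOn (fun _ : ℝ => (1:ℝ)) (Icc 0 1) := by simp
  have hadd : IntegrableOn (fun t => 2 * f t ^ 2 + 1) (Icc 0 1) := (hfi.const_mul 2).add hone
  have hdom : IntegrableOn (fun t => 2 * f t ^ 2 + 1 + ‖l' t‖ ^ 2) (Icc 0 1) := hadd.add hl.2
  have hint : IntegrableOn (fun t => 2 * f t * (1 + ‖l' t‖)) (Icc 0 1) := by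
    refine Integrable.mono' hdom ((hfm.const_mul 2).mul (aestronglyMeasurable_const.add hl.1.norm))
      (ae_of_all _ fun t => ?_)
    rw [Real.norm_of_nonneg (hnn t)]
    exact hle t
  refine ⟨hint, fun T hT => ?_⟩
  rw [intervalIntegral.integral_of_le hT.1]
  calc ∫ t in Ioc 0 T, 2 * f t * (1 + ‖l' t‖)
      ≤ ∫ t in Icc (0:ℝ) 1, 2 * f t * (1 + ‖l' t‖) :=
        setIntegral_mono_set hint (ae_of_all _ hnn)
          (Ioc_subset_Icc_self.trans (Icc_subset_Icc_right hT.2)).eventuallyLE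
    _ ≤ ∫ t in Icc (0:ℝ) 1, (2 * f t ^ 2 + 1 + ‖l' t‖ ^ 2) := integral_mono hint hdom hle
    _ = 2 * (∫ t in Icc (0:ℝ) 1, f t ^ 2) + 1 + ∫ t in Icc (0:ℝ) 1, ‖l' t‖ ^ 2 := by
        rw [integral_add hadd hl.2, integral_add (hfi.const_mul 2) hone,
          integral_const_mul]
        simp
    _ ≤ _ := by linarith

/-- Osgood-type stability: a primitive `z` of `ψ` stays in the ball of radius `r` if the growth rate
of `‖z‖²` is controlled there by an Osgood modulus up to an error of small total mass. -/
theorem norm_lt_of_inner_le_osgood {E : Type*} [NormedAddCommGroup E] [InnerProductSpace ℝ E]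
    [CompleteSpace E] {ψ z : ℝ → E} {η g e : ℝ → ℝ} {r a K : ℝ} (hr : 0 < r) (hr1 : r < 1)
    (hη : ContinuousOn η (Ico 0 1)) (hηm : MonotoneOn η (Ico 0 1)) (hη0 : 0 ≤ η 0)
    (hηpos : ∀ u ∈ Ioo (0:ℝ) 1, 0 < η u) (ha : a ∈ Ioo 0 (r ^ 2))
    (hg : ∀ t, 0 ≤ g t) (hgi : IntegrableOn g (Icc 0 1))
    (hgK : ∀ T ∈ Icc (0:ℝ) 1, ∫ s in (0:ℝ)..T, g s ≤ K)
    (hK : 2 * K < ∫ u in a..r ^ 2, (η u)⁻¹) (hei : IntegrableOn e (Icc 0 1))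
    (hea : ∀ T ∈ Icc (0:ℝ) 1, ∫ s in (0:ℝ)..T, e s ≤ a)
    (hψ : IntegrableOn ψ (Icc 0 1)) (hz : ContinuousOn z (Icc 0 1))
    (hzψ : ∀ t ∈ Icc (0:ℝ) 1, z t = ∫ s in (0:ℝ)..t, ψ s)
    (hin : ∀ s ∈ Icc (0:ℝ) 1, ‖z s‖ < r → 2 * ⟪z s, ψ s⟫ ≤ g s * η (‖z s‖ ^ 2) + e s) :
    ∀ t ∈ Icc (0:ℝ) 1, ‖z t‖ < r := by
  by_contra! hcon
  obtain ⟨t, ht, htr⟩ := hcon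
  have hcpt : IsCompact {t | t ∈ Icc (0:ℝ) 1 ∧ r ≤ ‖z t‖} := by
    refine isCompact_Icc.of_isClosed_subset
      (isClosed_Icc.isClosed_le (f := fun _ => r) continuousOn_const hz.norm) fun t ht => ht.1
  obtain ⟨T, ⟨hT, hTr⟩, hTmin⟩ := hcpt.exists_isLeast ⟨t, ht, htr⟩
  have hlt : ∀ s ∈ Ico 0 T, ‖z s‖ < r := fun s hs => by
    by_contra! h
    exact absurd (hTmin ⟨⟨hs.1, hs.2.le.trans hT.2⟩, h⟩) (not_le.2 hs.2)
  have hρ0 : 0 < r ^ 2 := by positivity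
  have hρ1 : r ^ 2 < 1 := pow_lt_one₀ hr.le hr1 two_ne_zero
  set φ : ℝ → ℝ := fun u => η (min (max u 0) (r ^ 2)) with hφ
  have hmem : ∀ u : ℝ, min (max u 0) (r ^ 2) ∈ Ico (0:ℝ) 1 := fun u =>
    ⟨le_min (le_max_right _ _) hρ0.le, (min_le_right _ _).trans_lt hρ1⟩
  have hφc : Continuous φ :=
    hη.comp_continuous ((continuous_id.max continuous_const).min continuous_const) hmem
  have hφm : Monotone φ := fun u v huv =>
    hηm (hmem u) (hmem v) (min_le_min (max_le_max huv le_rfl) le_rfl)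
  have hφpos : ∀ u, 0 < u → 0 < φ u := fun u hu =>
    hηpos _ ⟨lt_min (lt_max_of_lt_left hu) hρ0, (hmem u).2⟩
  have hφnn : ∀ u, 0 ≤ φ u := fun u =>
    hη0.trans (hηm ⟨le_rfl, one_pos⟩ (hmem u) (hmem u).1)
  have hφη : ∀ u ∈ Icc 0 (r ^ 2), φ u = η u := fun u hu => by
    simp only [hφ, max_eq_left hu.1, min_eq_left hu.2]
  have hTsub : Icc 0 T ⊆ Icc 0 1 := Icc_subset_Icc_right hT.2
  obtain ⟨hint, hen⟩ := norm_sq_le_integral_inner zero_le_one hψ hz hzψ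
  have hgφ : IntegrableOn (fun s => g s * φ (‖z s‖ ^ 2)) (Icc 0 1) :=
    hgi.mul_continuousOn (hφc.comp_continuousOn (hz.norm.pow 2)) isCompact_Icc
  have h01 : (0:ℝ) ∈ Icc (0:ℝ) 1 := ⟨le_rfl, zero_le_one⟩
  have hbound : ∀ t ∈ Icc 0 T, ‖z t‖ ^ 2 ≤ a + ∫ s in (0:ℝ)..t, g s * φ (‖z s‖ ^ 2) := by
    intro t ht
    have ht1 := hTsub ht
    have h1 : ∫ s in (0:ℝ)..t, 2 * ⟪z s, ψ s⟫ ≤ ∫ s in (0:ℝ)..t, (g s * φ (‖z s‖ ^ 2) + e s) := by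
      refine intervalIntegral.integral_mono_on_of_le_Ioo ht.1
        (hint.intervalIntegrable_of_mem h01 ht1)
        ((hgφ.intervalIntegrable_of_mem h01 ht1).add (hei.intervalIntegrable_of_mem h01 ht1))
        fun s hs => ?_
      have hsr := hlt s ⟨hs.1.le, hs.2.trans_le ht.2⟩
      rw [hφη _ ⟨sq_nonneg _, pow_le_pow_left₀ (norm_nonneg _) hsr.le 2⟩]
      exact hin s ⟨hs.1.le, hs.2.le.trans ht1.2⟩ hsr
    rw [intervalIntegral.integral_add (hgφ.intervalIntegrable_of_mem h01 ht1)
      (hei.intervalIntegrable_of_mem h01 ht1)] at h1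
    linarith [hen t ht1, hea t ht1]
  obtain ⟨w, hw, haw, hwint⟩ := integral_inv_le_of_le_add_integral ha.1 hT.1 hφc hφm hφpos hg
    (hgi.mono_set hTsub) ((hz.mono hTsub).norm.pow 2) (fun t _ => hφnn _) hbound
  have hρw : r ^ 2 ≤ w := (pow_le_pow_left₀ hr.le hTr 2).trans hw
  have hii : ∀ x y : ℝ, 0 < x → 0 < y → IntervalIntegrable (fun u => (φ u)⁻¹) volume x y :=
    fun x y hx hy => (hφc.continuousOn.inv₀ fun u hu =>
      (hφpos u ((lt_min hx hy).trans_le hu.1)).ne').intervalIntegrable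
  have heq : ∫ u in a..r ^ 2, (η u)⁻¹ = ∫ u in a..r ^ 2, (φ u)⁻¹ := by
    refine intervalIntegral.integral_congr fun u hu => ?_
    rw [uIcc_of_le ha.2.le] at hu
    simp only [hφη u ⟨ha.1.le.trans hu.1, hu.2⟩]
  have hsplit := intervalIntegral.integral_add_adjacent_intervals (hii a _ ha.1 hρ0)
    (hii _ w hρ0 (hρ0.trans_le hρw))
  have htail : 0 ≤ ∫ u in r ^ 2..w, (φ u)⁻¹ :=
    intervalIntegral.integral_nonneg hρw fun u _ => inv_nonneg.2 (hφnn u)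
  linarith [hgK T hT]

/-- Comparison of the velocities along `p` and `q` through an intermediate point `y`: the step from
`p s` to `y` is measured by `k₁`, the one from `y` to `q s` by the one-sided bound `k₂`. -/
theorem inner_velocity_sub_le {d m : ℕ}
    {b : ℝ → EuclideanSpace ℝ (Fin d) → EuclideanSpace ℝ (Fin d)}
    {σ : ℝ → EuclideanSpace ℝ (Fin d) → Matrix (Fin d) (Fin m) ℝ}
    {l' : ℝ → EuclideanSpace ℝ (Fin m)} {p q : ℝ → EuclideanSpace ℝ (Fin d)}
    {y : EuclideanSpace ℝ (Fin d)} {s k₁ k₂ r : ℝ}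
    (hmod : √(frobSq (σ s (p s) - σ s y)) + ‖b s (p s) - b s y‖ ≤ k₁)
    (hosg : max ⟪y - q s, b s y - b s (q s)⟫ ‖mVecT (σ s y - σ s (q s)) (y - q s)‖ ≤ k₂)
    (hr : ‖y - q s‖ ≤ r) :
    ⟪y - q s, velocity b σ l' p s - velocity b σ l' q s⟫ ≤ (k₂ + r * k₁) * (1 + ‖l' s‖) := by
  have hk₂ := le_of_max_le_left hosg
  have hk₂' := le_of_max_le_right hosg
  have hsq := Real.sqrt_nonneg (frobSq (σ s (p s) - σ s y))
  have e : velocity b σ l' p s - velocity b σ l' q s =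
      (b s (p s) - b s y) + (b s y - b s (q s)) + mVec (σ s (p s) - σ s y) (l' s)
        + mVec (σ s y - σ s (q s)) (l' s) := by
    simp only [velocity, mVec_sub]
    abel
  rw [e, inner_add_right, inner_add_right, inner_add_right, inner_mVec (σ s y - σ s (q s))]
  have hr0 : 0 ≤ r := (norm_nonneg _).trans hr
  have h1 : ⟪y - q s, b s (p s) - b s y⟫ + ⟪y - q s, mVec (σ s (p s) - σ s y) (l' s)⟫
      ≤ r * k₁ * (1 + ‖l' s‖) := by
    have i1 := (real_inner_le_norm (y - q s) (b s (p s) - b s y)).trans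
      (mul_le_mul hr (show ‖b s (p s) - b s y‖ ≤ k₁ by linarith) (norm_nonneg _) hr0)
    have i2 := (real_inner_le_norm (y - q s) (mVec (σ s (p s) - σ s y) (l' s))).trans
      (mul_le_mul hr ((norm_mVec_le _ _).trans (mul_le_mul_of_nonneg_right
        (show √(frobSq (σ s (p s) - σ s y)) ≤ k₁ by linarith [norm_nonneg (b s (p s) - b s y)])
        (norm_nonneg (l' s)))) (norm_nonneg _) hr0)
    linarith
  have h2 : ⟪mVecT (σ s y - σ s (q s)) (y - q s), l' s⟫ ≤ k₂ * ‖l' s‖ :=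
    (real_inner_le_norm _ _).trans (mul_le_mul_of_nonneg_right hk₂' (norm_nonneg _))
  linarith

/-- The last grid point `⌊ns⌋/n` before `s`. -/
theorem floor_grid_mem {n : ℕ} (hn : 0 < n) {s : ℝ} (hs : 0 ≤ s) :
    (⌊(n:ℝ) * s⌋₊ : ℝ) / n ∈ Icc (s - 1 / n) s := by
  have hn' : (0:ℝ) < n := by exact_mod_cast hn
  constructor
  · rw [sub_le_iff_le_add, ← add_div, le_div_iff₀ hn', mul_comm]
    exact (Nat.lt_floor_add_one _).le
  · rw [div_le_iff₀ hn', mul_comm s]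
    exact Nat.floor_le (by positivity)

/-- The mesh can be chosen so fine, uniformly over an energy sublevel set, that every trajectory
moves by at most `δ` between consecutive grid points. -/
theorem exists_mesh_norm_integral_velocity_le {d m : ℕ}
    {b : ℝ → EuclideanSpace ℝ (Fin d) → EuclideanSpace ℝ (Fin d)}
    {σ : ℝ → EuclideanSpace ℝ (Fin d) → Matrix (Fin d) (Fin m) ℝ} {B S : ℝ → ℝ}
    (hBi : IntegrableOn B (Icc 0 1)) (hSi : IntegrableOn S (Icc 0 1))
    (hB : ∀ᵐ s ∂(volume.restrict (Icc (0:ℝ) 1)), ∀ x, ‖b s x‖ ≤ B s)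
    (hS : ∀ᵐ s ∂(volume.restrict (Icc (0:ℝ) 1)), ∀ x, frobSq (σ s x) ≤ S s)
    {α δ : ℝ} (hα : 0 < α) (hδ : 0 < δ) :
    ∃ N : ℕ, 1 ≤ N ∧ ∀ n ≥ N, ∀ l' : ℝ → EuclideanSpace ℝ (Fin m), Adm l' →
      (∫ t in Icc (0:ℝ) 1, ‖l' t‖ ^ 2) ≤ α → ∀ h : ℝ → EuclideanSpace ℝ (Fin d),
        ∀ s ∈ Icc (0:ℝ) 1,
          ‖∫ t in ((⌊(n:ℝ) * s⌋₊ : ℝ) / n)..s, velocity b σ l' h t‖ ≤ δ := by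
  set c : ℝ := α / δ with hc
  have hc0 : 0 < c := by positivity
  have hI : IntegrableOn (fun s => B s + c / 2 * S s) (Icc 0 1) := hBi.add (hSi.const_mul (c / 2))
  have huc := isCompact_Icc.uniformContinuousOn_of_continuous
    (hI.continuousOn_primitive zero_le_one)
  obtain ⟨τ, hτ, hτδ⟩ := Metric.uniformContinuousOn_iff.1 huc (δ / 2) (by positivity)
  obtain ⟨N, hN⟩ := exists_nat_gt (1 / τ)
  have hN0 : (0:ℝ) < N := lt_trans (by positivity) hN
  refine ⟨N, by exact_mod_cast hN0, fun n hn l' hl hlα h s hs => ?_⟩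
  have hNn : (N:ℝ) ≤ n := by exact_mod_cast hn
  have hn0 : (0:ℝ) < n := hN0.trans_le hNn
  have hk := floor_grid_mem (by exact_mod_cast hn0 : 0 < n) hs.1
  set k : ℝ := (⌊(n:ℝ) * s⌋₊ : ℝ) / n with hk'
  have hkI : k ∈ Icc (0:ℝ) 1 := ⟨by positivity, hk.2.trans hs.2⟩
  have hnτ : 1 / (n:ℝ) < τ := by
    rw [div_lt_comm₀ hn0 hτ]
    exact hN.trans_le hNn
  have hd := hτδ s hs k hkI (by
    rw [Real.dist_eq, abs_of_nonneg (by linarith [hk.2])]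
    linarith [hk.1])
  have h01 : (0:ℝ) ∈ Icc (0:ℝ) 1 := ⟨le_rfl, zero_le_one⟩
  rw [Real.dist_eq, intervalIntegral.integral_interval_sub_left
    (hI.intervalIntegrable_of_mem h01 hs) (hI.intervalIntegrable_of_mem h01 hkI)] at hd
  have h1 := norm_integral_velocity_le (h := h) hBi hSi hB hS hl hlα hc0 hkI hs hk.2
  have h2 : α / (2 * c) = δ / 2 := by
    rw [hc]
    field_simp
  rw [h2] at h1
  linarith [(abs_lt.1 hd).2]

theorem continuous_of_norm_sub_le {E F : Type*} [NormedAddCommGroup E] [NormedAddCommGroup F]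
    {u : E → F} {H : ℝ → ℝ} {C : ℝ} (hH : ContinuousOn H (Ici 0)) (hH0 : H 0 = 0)
    (hu : ∀ x y, ‖u x - u y‖ ≤ C * H ‖x - y‖) : Continuous u := by
  refine continuous_iff_continuousAt.2 fun y => ?_
  refine tendsto_iff_norm_sub_tendsto_zero.2 ?_
  have h1 : Tendsto (fun x => ‖x - y‖) (𝓝 y) (𝓝[Ici 0] 0) := by
    refine tendsto_nhdsWithin_iff.2 ⟨?_, Eventually.of_forall fun x => norm_nonneg _⟩
    have : Continuous fun x : E => ‖x - y‖ := by fun_prop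
    simpa using this.tendsto y
  have h0 : Tendsto H (𝓝[Ici 0] 0) (𝓝 0) := by
    simpa only [ContinuousWithinAt, hH0] using hH 0 self_mem_Ici
  have h2 : Tendsto (fun x => C * H ‖x - y‖) (𝓝 y) (𝓝 (C * 0)) := (h0.comp h1).const_mul C
  rw [mul_zero] at h2
  exact squeeze_zero (fun x => norm_nonneg _) (fun x => hu x y) h2

/-- A nondecreasing Osgood modulus is positive away from `0`. -/
theorem pos_of_lintegral_inv_eq_top {η : ℝ → ℝ} (hηm : MonotoneOn η (Ico 0 1))
    (hη0 : ∀ u ∈ Ico (0:ℝ) 1, 0 ≤ η u)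
    (htop : ∀ ε ∈ Ioo (0:ℝ) 1, ∫⁻ u in Ioc (0:ℝ) ε, ENNReal.ofReal (1 / η u) = ⊤) :
    ∀ u ∈ Ioo (0:ℝ) 1, 0 < η u := by
  intro u hu
  by_contra! hneg
  have h1 : ∫⁻ w in Ioc (0:ℝ) u, ENNReal.ofReal (1 / η w) = 0 := by
    rw [setLIntegral_congr_fun (g := fun _ => 0) measurableSet_Ioc fun w hw => ?_, lintegral_zero]
    have hwI : w ∈ Ico (0:ℝ) 1 := ⟨hw.1.le, hw.2.trans_lt hu.2⟩
    have : η w = 0 := le_antisymm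
      ((hηm hwI ⟨hu.1.le, hu.2⟩ hw.2).trans hneg) (hη0 w hwI)
    simp [this]
  rw [htop u hu] at h1
  exact ENNReal.top_ne_zero h1

/-- under the boundedness of the coefficients, the
modulus-of-continuity condition and the local Osgood-type condition, the Euler
approximations converge to the controlled trajectories uniformly on `[0,1]`,
uniformly over the energy sublevel set `{l : e(l) ≤ α}`. -/
theorem euler_uniform_convergence {d m : ℕ} (hd : 1 ≤ d) (hm : 1 ≤ m)
    (x₀ : EuclideanSpace ℝ (Fin d))
    (b : ℝ → EuclideanSpace ℝ (Fin d) → EuclideanSpace ℝ (Fin d))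
    (σ : ℝ → EuclideanSpace ℝ (Fin d) → Matrix (Fin d) (Fin m) ℝ)
    (hbmeas : Measurable (Function.uncurry b))
    (hσmeas : ∀ i j, Measurable fun p : ℝ × EuclideanSpace ℝ (Fin d) => σ p.1 p.2 i j)
    -- boundedness: ∫₀¹ sup_x |b(s,x)| ds < ∞ and ∫₀¹ sup_x ‖σ(s,x)‖² ds < ∞
    (hb_bdd : ∫⁻ s in Icc (0:ℝ) 1,
      ⨆ x : EuclideanSpace ℝ (Fin d), ENNReal.ofReal ‖b s x‖ < ⊤)
    (hσ_bdd : ∫⁻ s in Icc (0:ℝ) 1,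
      ⨆ x : EuclideanSpace ℝ (Fin d), ENNReal.ofReal (frobSq (σ s x)) < ⊤)
    -- modulus-of-continuity condition
    (H G : ℝ → ℝ)
    (hH_cont : ContinuousOn H (Ici 0)) (hH_mono : MonotoneOn H (Ici 0))
    (hH0 : H 0 = 0) (hH_nonneg : ∀ u ∈ Ici (0:ℝ), 0 ≤ H u)
    (hG_nonneg : ∀ t, 0 ≤ G t)
    (hG_int : IntegrableOn (fun t => G t ^ 2) (Icc 0 1))
    (hmod : ∀ t ∈ Icc (0:ℝ) 1, ∀ x y,
      Real.sqrt (frobSq (σ t x - σ t y)) + ‖b t x - b t y‖ ≤ G t * H ‖x - y‖)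
    -- local Osgood-type condition
    (c₀ : ℝ) (hc₀ : c₀ ∈ Ioo (0:ℝ) 1)
    (hOsg : ∀ R > (0:ℝ), ∃ f η : ℝ → ℝ,
      (∀ t, 0 ≤ f t) ∧ IntegrableOn (fun t => f t ^ 2) (Icc 0 1) ∧
      DifferentiableOn ℝ η (Ico 0 1) ∧ η 0 = 0 ∧
      (∀ u ∈ Ico (0:ℝ) 1, 0 ≤ η u) ∧
      (∀ u ∈ Ico (0:ℝ) 1, 0 ≤ derivWithin η (Ico 0 1) u) ∧
      (∀ ε ∈ Ioo (0:ℝ) 1, ∫⁻ u in Ioc (0:ℝ) ε, ENNReal.ofReal (1 / η u) = ⊤) ∧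
      (∀ t ∈ Icc (0:ℝ) 1, ∀ x y : EuclideanSpace ℝ (Fin d),
        max ‖x‖ ‖y‖ ≤ R → ‖x - y‖ < c₀ →
        max ⟪x - y, b t x - b t y⟫ ‖mVecT (σ t x - σ t y) (x - y)‖
          ≤ f t * η (‖x - y‖ ^ 2)))
    -- for every control with finite energy the controlled equation has a solution
    (hex : ∀ l' : ℝ → EuclideanSpace ℝ (Fin m), Adm l' → ∃ h, IsSol b σ x₀ l' h) :
    -- conclusion: lim_n sup_{e(l) ≤ α} sup_{t ∈ [0,1]} |Fₙ(l)(t) − F(l)(t)| = 0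
    ∀ α > (0:ℝ), ∀ ε > (0:ℝ), ∃ N : ℕ, 1 ≤ N ∧ ∀ n ≥ N,
      ∀ l' : ℝ → EuclideanSpace ℝ (Fin m), Adm l' →
        (∫ t in Icc (0:ℝ) 1, ‖l' t‖ ^ 2) ≤ α →
        ∀ F Fn : ℝ → EuclideanSpace ℝ (Fin d),
          IsSol b σ x₀ l' F → IsEuler n b σ x₀ l' Fn →
          ∀ t ∈ Icc (0:ℝ) 1, ‖Fn t - F t‖ ≤ ε := by
  intro α hα ε hε
  obtain ⟨B, hB0, hBi, hB⟩ := exists_integrable_majorant (g := fun s x => ‖b s x‖)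
    (fun x => (hbmeas.comp (measurable_id.prodMk measurable_const)).norm)
    (fun s hs => (continuous_of_norm_sub_le hH_cont hH0 fun x y =>
      (le_add_of_nonneg_left (Real.sqrt_nonneg _)).trans (hmod s hs x y)).norm) hb_bdd
  obtain ⟨S, hS0, hSi, hS⟩ := exists_integrable_majorant (g := fun s x => frobSq (σ s x))
    (fun x => Finset.measurable_fun_sum _ fun i _ => Finset.measurable_fun_sum _ fun j _ =>
      ((hσmeas i j).comp (measurable_id.prodMk measurable_const)).pow_const 2)
    (fun s hs => continuous_finsetSum _ fun i _ => continuous_finsetSum _ fun j _ =>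
      (continuous_of_norm_sub_le hH_cont hH0 fun x y =>
        (abs_entry_le_sqrt_frobSq (σ s x - σ s y) i j).trans
          ((le_add_of_nonneg_right (norm_nonneg _)).trans (hmod s hs x y))).pow 2) hσ_bdd
  have h01 : (0:ℝ) ∈ Icc (0:ℝ) 1 := ⟨le_rfl, zero_le_one⟩
  have hI : IntegrableOn (fun s => B s + 1 / 2 * S s) (Icc 0 1) := hBi.add (hSi.const_mul (1 / 2))
  set R : ℝ := ‖x₀‖ + ((∫ s in (0:ℝ)..1, (B s + 1 / 2 * S s)) + α / (2 * 1)) with hR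
  have hBS : ∀ s, 0 ≤ B s + 1 / 2 * S s := fun s => by linarith [hB0 s, hS0 s]
  have hRpos : 0 < R := by
    have := intervalIntegral.integral_nonneg (μ := volume) zero_le_one fun s _ => hBS s
    positivity
  obtain ⟨f, η, hf0, hfi, hηd, -, hηnn, hηd0, hηtop, hosg⟩ := hOsg R hRpos
  have hηc := hηd.continuousOn
  have hηm : MonotoneOn η (Ico 0 1) :=
    monotoneOn_of_deriv_nonneg (convex_Ico 0 1) hηc (hηd.mono interior_subset) fun u hu => by
      rw [← derivWithin_of_mem_nhds (mem_interior_iff_mem_nhds.1 hu)]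
      exact hηd0 u (interior_subset hu)
  have hηpos := pos_of_lintegral_inv_eq_top hηm hηnn hηtop
  set r : ℝ := min ε (c₀ / 2) with hr
  have hr0 : 0 < r := lt_min hε (half_pos hc₀.1)
  have hrc : r < c₀ := (min_le_right _ _).trans_lt (half_lt_self hc₀.1)
  have hr1 : r < 1 := hrc.trans hc₀.2
  have hρ1 : r ^ 2 < 1 := pow_lt_one₀ hr0.le hr1 two_ne_zero
  obtain ⟨a, ha, haK⟩ := exists_lt_integral_inv_of_lintegral_eq_top (pow_pos hr0 2)
    (hηc.mono fun u hu => ⟨hu.1.le, hu.2.trans_lt hρ1⟩)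
    (fun u hu => hηpos u ⟨hu.1, hu.2.trans_lt hρ1⟩) (hηtop _ ⟨pow_pos hr0 2, hρ1⟩)
    (2 * (2 * (∫ t in Icc (0:ℝ) 1, f t ^ 2) + 1 + α))
  set CG : ℝ := 2 * (∫ t in Icc (0:ℝ) 1, G t ^ 2) + 1 + α
  have hCGpos : 0 < CG := by
    have : 0 ≤ ∫ t in Icc (0:ℝ) 1, G t ^ 2 := integral_nonneg fun t => sq_nonneg _
    positivity
  obtain ⟨δ, hδ, hδH⟩ : ∃ δ > 0, H δ * CG ≤ a := by
    obtain ⟨δ, hδ, h⟩ := Metric.continuousOn_iff.1 hH_cont 0 self_mem_Ici (a / CG)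
      (div_pos ha.1 hCGpos)
    have h1 := h (δ / 2) (half_pos hδ).le (by
      rw [Real.dist_eq, sub_zero, abs_of_pos (half_pos hδ)]
      linarith)
    rw [hH0, Real.dist_eq, sub_zero, lt_div_iff₀ hCGpos] at h1
    exact ⟨δ / 2, half_pos hδ,
      (mul_le_mul_of_nonneg_right (le_abs_self _) hCGpos.le).trans h1.le⟩
  obtain ⟨N, hN1, hN⟩ := exists_mesh_norm_integral_velocity_le hBi hSi hB hS hα hδ
  refine ⟨N, hN1, fun n hn l' hl hlα F Fn hF hFn => ?_⟩
  have hn0 : 0 < n := hN1.trans hn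
  set p : ℝ → EuclideanSpace ℝ (Fin d) := fun s => Fn ((⌊(n:ℝ) * s⌋₊ : ℝ) / n) with hp
  have hFeq : ∀ t ∈ Icc (0:ℝ) 1, F t = x₀ + ∫ s in (0:ℝ)..t, velocity b σ l' F s := hF.2
  have hFneq : ∀ t ∈ Icc (0:ℝ) 1, Fn t = x₀ + ∫ s in (0:ℝ)..t, velocity b σ l' p s := hFn
  have hpm : Measurable p :=
    (measurable_from_nat (f := fun k : ℕ => Fn ((k:ℝ) / n))).comp
      (Nat.measurable_floor.comp (measurable_const.mul measurable_id))
  have hvF := integrableOn_velocity hbmeas hσmeas hBi hSi hB hS hl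
    (hF.1.aemeasurable measurableSet_Icc)
  have hvp := integrableOn_velocity hbmeas hσmeas hBi hSi hB hS hl hpm.aemeasurable
  have hbound : ∀ h : ℝ → EuclideanSpace ℝ (Fin d), ∀ t ∈ Icc (0:ℝ) 1,
      ‖x₀ + ∫ s in (0:ℝ)..t, velocity b σ l' h s‖ ≤ R := by
    intro h t ht
    refine (norm_add_le _ _).trans (add_le_add_right ?_ _)
    refine (norm_integral_velocity_le hBi hSi hB hS hl hlα one_pos h01 ht ht.1).trans ?_
    refine add_le_add_left ?_ _
    exact intervalIntegral.integral_mono_interval le_rfl ht.1 ht.2 (ae_of_all _ hBS)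
      (hI.intervalIntegrable_of_mem h01 ⟨zero_le_one, le_rfl⟩)
  obtain ⟨hgi, hgK⟩ := integrableOn_mul_one_add_norm hf0 hfi hl hlα
  obtain ⟨hei, heK⟩ := integrableOn_mul_one_add_norm hG_nonneg hG_int hl hlα
  have hzeq : ∀ t ∈ Icc (0:ℝ) 1,
      Fn t - F t = ∫ s in (0:ℝ)..t, (velocity b σ l' p s - velocity b σ l' F s) := by
    intro t ht
    rw [hFeq t ht, hFneq t ht, intervalIntegral.integral_sub
      (hvp.intervalIntegrable_of_mem h01 ht) (hvF.intervalIntegrable_of_mem h01 ht)]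
    abel
  have hψ : IntegrableOn (fun s => velocity b σ l' p s - velocity b σ l' F s) (Icc 0 1) :=
    hvp.sub hvF
  have hz : ContinuousOn (fun t => Fn t - F t) (Icc 0 1) :=
    (hψ.continuousOn_primitive zero_le_one).congr hzeq
  have hlt := norm_lt_of_inner_le_osgood (z := fun t => Fn t - F t) hr0 hr1 hηc hηm
    (hηnn 0 ⟨le_rfl, one_pos⟩) hηpos ha (fun t => by have := hf0 t; positivity) hgi hgK haK
    (e := fun t => H δ * (2 * G t * (1 + ‖l' t‖))) (hei.const_mul (H δ)) ?_ hψ hz hzeq ?_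
  · exact fun t ht => (hlt t ht).le.trans (min_le_left _ _)
  · intro T hT
    rw [intervalIntegral.integral_const_mul]
    exact (mul_le_mul_of_nonneg_left (heK T hT) (hH_nonneg δ hδ.le)).trans hδH
  · intro s hs hsr
    have hkm := floor_grid_mem hn0 hs.1
    have hkI : (⌊(n:ℝ) * s⌋₊ : ℝ) / n ∈ Icc (0:ℝ) 1 := ⟨by positivity, hkm.2.trans hs.2⟩
    have hclose : ‖p s - Fn s‖ ≤ δ := by
      rw [norm_sub_rev]
      have : Fn s - p s = ∫ t in ((⌊(n:ℝ) * s⌋₊ : ℝ) / n)..s, velocity b σ l' p t := by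
        rw [show p s = Fn ((⌊(n:ℝ) * s⌋₊ : ℝ) / n) from rfl, hFneq s hs, hFneq _ hkI,
          add_sub_add_left_eq_sub]
        exact intervalIntegral.integral_interval_sub_left
          (hvp.intervalIntegrable_of_mem h01 hs) (hvp.intervalIntegrable_of_mem h01 hkI)
      rw [this]
      exact hN n hn l' hl hlα p s hs
    have hHle : H ‖p s - Fn s‖ ≤ H δ := hH_mono (norm_nonneg _) hδ.le hclose
    have h1 := inner_velocity_sub_le (l' := l') (p := p) (q := F)
      ((hmod s hs (p s) (Fn s)).trans (mul_le_mul_of_nonneg_left hHle (hG_nonneg s)))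
      (hosg s hs (Fn s) (F s)
        (max_le (hFneq s hs ▸ hbound p s hs) (hFeq s hs ▸ hbound F s hs)) (hsr.trans hrc)) hsr.le
    have h2 : r * (G s * H δ) * (1 + ‖l' s‖) ≤ 1 * (G s * H δ) * (1 + ‖l' s‖) := by
      have := hG_nonneg s
      have := hH_nonneg δ hδ.le
      gcongr
    linarith
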